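/- Let H be a quasi-Hopf algebra over a field k with bijective antipode S (inverse S̄), μ : H → k an algebra map, f the Drinfeld twist, U^L = f̄1S(q^R_2) ⊗ f̄2S(q^R_1), V^L = S̄(f2 p^R_2) ⊗ S̄(f1 p^R_1), and W^L = μ(φ̄1)·f̄1S(q^R_2 φ̄3) ⊗ f̄2S((q^R_1 ↼ μ)φ̄2), where h ↼ μ = μ(h_(1))h_(2). Then for λ ∈ H* the following are equivalent: (i) V^L_1 h_(1) U^L_1 · ⟨λ, V^L_2 h_(2) U^L_2⟩ = μ(φ̄1)·⟨λ, hS(φ̄2)⟩·φ̄3 for all h ∈ H; (ii) V^L_1 h_(1) W^L_1 · ⟨λ, V^L_2 h_(2) W^L_2⟩ = λ(h)·1 for all h ∈ H. -/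

import Mathlib

open scoped TensorProduct

noncomputable section

/-- A quasi-Hopf algebra over a field `k`, presented together with explicit
(Sweedler-style) finite representations of the comultiplication and of the
associator `φ` and its inverse `φ⁻¹`.  The fields `n, d1, d2` give, for every
`h : H`, a finite family with `Δ h = ∑ i < n h, d1 h i ⊗ d2 h i`; similarly
`P1, P2, P3` (resp. `Q1, Q2, Q3`) are the components of `φ` (resp. `φ⁻¹`). -/
structure QuasiHopf (k H : Type) [Field k] [Ring H] [Algebra k H] where
  comul : H →ₐ[k] H ⊗[k] H
  counit : H →ₐ[k] k
  n : H → ℕ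
  d1 : H → ℕ → H
  d2 : H → ℕ → H
  comul_eq : ∀ h, comul h = ∑ i ∈ Finset.range (n h), d1 h i ⊗ₜ[k] d2 h i
  np : ℕ
  P1 : ℕ → H
  P2 : ℕ → H
  P3 : ℕ → H
  nq : ℕ
  Q1 : ℕ → H
  Q2 : ℕ → H
  Q3 : ℕ → H
  S : H →ₗ[k] H
  Sinv : H →ₗ[k] H
  alpha : H
  beta : H
  S_one : S 1 = 1
  S_mul : ∀ x y : H, S (x * y) = S y * S x
  Sinv_S : ∀ x : H, Sinv (S x) = x
  S_Sinv : ∀ x : H, S (Sinv x) = x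
  phi_phiInv :
    (∑ a ∈ Finset.range np, P1 a ⊗ₜ[k] (P2 a ⊗ₜ[k] P3 a)) *
      (∑ b ∈ Finset.range nq, Q1 b ⊗ₜ[k] (Q2 b ⊗ₜ[k] Q3 b)) = 1
  phiInv_phi :
    (∑ b ∈ Finset.range nq, Q1 b ⊗ₜ[k] (Q2 b ⊗ₜ[k] Q3 b)) *
      (∑ a ∈ Finset.range np, P1 a ⊗ₜ[k] (P2 a ⊗ₜ[k] P3 a)) = 1
  qcoassoc : ∀ h : H,
    ∑ i ∈ Finset.range (n h), d1 h i ⊗ₜ[k] comul (d2 h i) =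
      (∑ a ∈ Finset.range np, P1 a ⊗ₜ[k] (P2 a ⊗ₜ[k] P3 a)) *
        (∑ i ∈ Finset.range (n h), ∑ j ∈ Finset.range (n (d1 h i)),
          d1 (d1 h i) j ⊗ₜ[k] (d2 (d1 h i) j ⊗ₜ[k] d2 h i)) *
        (∑ b ∈ Finset.range nq, Q1 b ⊗ₜ[k] (Q2 b ⊗ₜ[k] Q3 b))
  counit_left : ∀ h : H, ∑ i ∈ Finset.range (n h), counit (d1 h i) • d2 h i = h
  counit_right : ∀ h : H, ∑ i ∈ Finset.range (n h), counit (d2 h i) • d1 h i = h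
  pentagon :
    (∑ a ∈ Finset.range np, P1 a ⊗ₜ[k] (P2 a ⊗ₜ[k] comul (P3 a))) *
      (∑ a ∈ Finset.range np, ∑ i ∈ Finset.range (n (P1 a)),
        d1 (P1 a) i ⊗ₜ[k] (d2 (P1 a) i ⊗ₜ[k] (P2 a ⊗ₜ[k] P3 a))) =
    ((1 : H) ⊗ₜ[k] (∑ a ∈ Finset.range np, P1 a ⊗ₜ[k] (P2 a ⊗ₜ[k] P3 a))) *
      (∑ a ∈ Finset.range np, ∑ i ∈ Finset.range (n (P2 a)),
        P1 a ⊗ₜ[k] (d1 (P2 a) i ⊗ₜ[k] (d2 (P2 a) i ⊗ₜ[k] P3 a))) *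
      (∑ a ∈ Finset.range np, P1 a ⊗ₜ[k] (P2 a ⊗ₜ[k] (P3 a ⊗ₜ[k] (1 : H))))
  counit_mid_phi :
    ∑ a ∈ Finset.range np, counit (P2 a) • (P1 a ⊗ₜ[k] P3 a) = (1 : H) ⊗ₜ[k] (1 : H)
  antipode_alpha : ∀ h : H,
    ∑ i ∈ Finset.range (n h), S (d1 h i) * alpha * d2 h i = counit h • alpha
  antipode_beta : ∀ h : H,
    ∑ i ∈ Finset.range (n h), d1 h i * beta * S (d2 h i) = counit h • beta
  nondeg_1 : ∑ a ∈ Finset.range np, P1 a * beta * S (P2 a) * alpha * P3 a = 1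
  nondeg_2 : ∑ b ∈ Finset.range nq, S (Q1 b) * alpha * Q2 b * beta * S (Q3 b) = 1
  counit_alpha : counit alpha = 1
  counit_beta : counit beta = 1

namespace QuasiHopf

variable {k H : Type} [Field k] [Ring H] [Algebra k H] (q : QuasiHopf k H)

/-- The associator `φ` as an element of `H ⊗ H ⊗ H`. -/
def Phi : H ⊗[k] (H ⊗[k] H) :=
  ∑ a ∈ Finset.range q.np, q.P1 a ⊗ₜ[k] (q.P2 a ⊗ₜ[k] q.P3 a)

/-- `φ⁻¹` as an element of `H ⊗ H ⊗ H`. -/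
def PhiInv : H ⊗[k] (H ⊗[k] H) :=
  ∑ b ∈ Finset.range q.nq, q.Q1 b ⊗ₜ[k] (q.Q2 b ⊗ₜ[k] q.Q3 b)

/-- first components of `p^R = φ̄1 ⊗ φ̄2 β S(φ̄3)` -/
def pR1 (b : ℕ) : H := q.Q1 b

def pR2 (b : ℕ) : H := q.Q2 b * q.beta * q.S (q.Q3 b)

def pRE : H ⊗[k] H := ∑ b ∈ Finset.range q.nq, q.pR1 b ⊗ₜ[k] q.pR2 b

/-- components of `q^R = φ1 ⊗ S̄(α φ3) φ2` -/
def qR1 (a : ℕ) : H := q.P1 a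

def qR2 (a : ℕ) : H := q.Sinv (q.alpha * q.P3 a) * q.P2 a

def qRE : H ⊗[k] H := ∑ a ∈ Finset.range q.np, q.qR1 a ⊗ₜ[k] q.qR2 a

/-- components of `p^L = φ2 S̄(φ1 β) ⊗ φ3` -/
def pL1 (a : ℕ) : H := q.P2 a * q.Sinv (q.P1 a * q.beta)

def pL2 (a : ℕ) : H := q.P3 a

def pLE : H ⊗[k] H := ∑ a ∈ Finset.range q.np, q.pL1 a ⊗ₜ[k] q.pL2 a

/-- components of `q^L = S(φ̄1) α φ̄2 ⊗ φ̄3` -/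
def qL1 (b : ℕ) : H := q.S (q.Q1 b) * q.alpha * q.Q2 b

def qL2 (b : ℕ) : H := q.Q3 b

def qLE : H ⊗[k] H := ∑ b ∈ Finset.range q.nq, q.qL1 b ⊗ₜ[k] q.qL2 b

/-- `𝕒 = S(φ̄1 φ2) α φ̄2 φ3₍₁₎ ⊗ S(φ1) α φ̄3 φ3₍₂₎` -/
def aEl : H ⊗[k] H :=
  ∑ a ∈ Finset.range q.np, ∑ b ∈ Finset.range q.nq, ∑ m ∈ Finset.range (q.n (q.P3 a)),
    (q.S (q.Q1 b * q.P2 a) * q.alpha * q.Q2 b * q.d1 (q.P3 a) m) ⊗ₜ[k]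
      (q.S (q.P1 a) * q.alpha * q.Q3 b * q.d2 (q.P3 a) m)

/-- `𝕓 = φ1₍₁₎ φ̄1 β S(φ3) ⊗ φ1₍₂₎ φ̄2 β S(φ2 φ̄3)` -/
def bEl : H ⊗[k] H :=
  ∑ a ∈ Finset.range q.np, ∑ b ∈ Finset.range q.nq, ∑ m ∈ Finset.range (q.n (q.P1 a)),
    (q.d1 (q.P1 a) m * q.Q1 b * q.beta * q.S (q.P3 a)) ⊗ₜ[k]
      (q.d2 (q.P1 a) m * q.Q2 b * q.beta * q.S (q.P2 a * q.Q3 b))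

/-- `(S ⊗ S)(Δ^cop x) = S(x₍₂₎) ⊗ S(x₍₁₎)` -/
def scop (x : H) : H ⊗[k] H :=
  ∑ m ∈ Finset.range (q.n x), q.S (q.d2 x m) ⊗ₜ[k] q.S (q.d1 x m)

/-- The Drinfeld twist `f = (S⊗S)(Δ^cop(p^R_1)) · 𝕒 · Δ(p^R_2)`. -/
def twist : H ⊗[k] H :=
  ∑ b ∈ Finset.range q.nq, q.scop (q.pR1 b) * q.aEl * q.comul (q.pR2 b)

/-- `f⁻¹ = Δ(q^L_1) · 𝕓 · (S⊗S)(Δ^cop(q^L_2))`. -/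
def twistInv : H ⊗[k] H :=
  ∑ b ∈ Finset.range q.nq, q.comul (q.qL1 b) * q.bEl * q.scop (q.qL2 b)

/-- `x ⊗ y ↦ S y ⊗ S x` -/
def sswap : H ⊗[k] H →ₗ[k] H ⊗[k] H :=
  (TensorProduct.map q.S q.S).comp (TensorProduct.comm k H H).toLinearMap

/-- `x ⊗ y ↦ S̄ y ⊗ S̄ x` -/
def sswapInv : H ⊗[k] H →ₗ[k] H ⊗[k] H :=
  (TensorProduct.map q.Sinv q.Sinv).comp (TensorProduct.comm k H H).toLinearMap

/-- `U^L = f̄1 S(q^R_2) ⊗ f̄2 S(q^R_1)` -/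
def UL : H ⊗[k] H := q.twistInv * q.sswap q.qRE

/-- `V^L = S̄(f2 p^R_2) ⊗ S̄(f1 p^R_1)` -/
def VL : H ⊗[k] H := q.sswapInv (q.twist * q.pRE)

/-- `U^R = S̄(q^L_2 f̄2) ⊗ S̄(q^L_1 f̄1)` -/
def UR : H ⊗[k] H := q.sswapInv (q.qLE * q.twistInv)

/-- `V^R = S(p^L_2) f1 ⊗ S(p^L_1) f2` -/
def VR : H ⊗[k] H := q.sswap q.pLE * q.twist

/-- `h ↦ h ↼ μ = μ(h₍₁₎) h₍₂₎` -/
def lhook (mu : H →ₐ[k] k) : H →ₗ[k] H :=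
  (TensorProduct.lid k H).toLinearMap.comp
    ((TensorProduct.map mu.toLinearMap LinearMap.id).comp q.comul.toLinearMap)

/-- `h ↦ μ ⇀ h = μ(h₍₂₎) h₍₁₎` -/
def rhook (mu : H →ₐ[k] k) : H →ₗ[k] H :=
  (TensorProduct.rid k H).toLinearMap.comp
    ((TensorProduct.map LinearMap.id mu.toLinearMap).comp q.comul.toLinearMap)

/-- `W^L = μ(φ̄1) f̄1 S(q^R_2 φ̄3) ⊗ f̄2 S((q^R_1 ↼ μ) φ̄2)` -/
def WL (mu : H →ₐ[k] k) : H ⊗[k] H :=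
  q.twistInv * q.sswap ((TensorProduct.map (q.lhook mu) LinearMap.id q.qRE) *
    (∑ b ∈ Finset.range q.nq, mu (q.Q1 b) • (q.Q2 b ⊗ₜ[k] q.Q3 b)))

/-- `W^R = μ(φ3) S̄((μ ⇀ q^L_2) φ2 f̄2) ⊗ S̄(q^L_1 φ1 f̄1)` -/
def WR (mu : H →ₐ[k] k) : H ⊗[k] H :=
  q.sswapInv ((TensorProduct.map LinearMap.id (q.rhook mu) q.qLE) *
    (∑ a ∈ Finset.range q.np, mu (q.P3 a) • (q.P1 a ⊗ₜ[k] q.P2 a)) * q.twistInv)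

section Modules

variable {V W X : Type} [AddCommGroup V] [Module k V] [AddCommGroup W] [Module k W]
  [AddCommGroup X] [Module k X]

/-- The tensor-product action `h · (v ⊗ w) = h₍₁₎ v ⊗ h₍₂₎ w`. -/
def tensAct (ρV : H → Module.End k V) (ρW : H → Module.End k W) (h : H) :
    Module.End k (V ⊗[k] W) :=
  ∑ i ∈ Finset.range (q.n h), TensorProduct.map (ρV (q.d1 h i)) (ρW (q.d2 h i))

/-- The action on the left dual: `(h · ξ)(x) = ξ(S(h) x)`. -/
def dualAct (ρX : H → Module.End k X) (h : H) : Module.End k (Module.Dual k X) :=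
  LinearMap.dualMap (ρX (q.S h))

end Modules

end QuasiHopf

/-- `f` intertwines the two given `H`-actions. -/
def IsHLin {k H V W : Type} [Field k] [Ring H] [Algebra k H]
    [AddCommGroup V] [Module k V] [AddCommGroup W] [Module k W]
    (ρV : H → Module.End k V) (ρW : H → Module.End k W) (f : V →ₗ[k] W) : Prop :=
  ∀ (h : H) (v : V), f (ρV h v) = ρW h (f v)

/-- `x ⊗ y ↦ λ(y) • x` -/
def hitR {k H : Type} [Field k] [Ring H] [Algebra k H] (lam : H →ₗ[k] k) :
    H ⊗[k] H →ₗ[k] H :=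
  (TensorProduct.rid k H).toLinearMap.comp (TensorProduct.map LinearMap.id lam)

/-- `x ⊗ y ↦ λ(x) • y` -/
def hitL {k H : Type} [Field k] [Ring H] [Algebra k H] (lam : H →ₗ[k] k) :
    H ⊗[k] H →ₗ[k] H :=
  (TensorProduct.lid k H).toLinearMap.comp (TensorProduct.map lam LinearMap.id)

namespace QuasiHopf

variable {k H : Type} [Field k] [Ring H] [Algebra k H] (q : QuasiHopf k H)

set_option maxSynthPendingDepth 6

/-- `x ⊗ y ↦ Δ x ⊗ y`, reassociated to the right -/
def comulFst (A : Type) [Ring A] [Algebra k A] : H ⊗[k] A →ₐ[k] H ⊗[k] (H ⊗[k] A) :=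
  (Algebra.TensorProduct.assoc k k k H H A).toAlgHom.comp
    (Algebra.TensorProduct.map q.comul (AlgHom.id k A))

/-- `x ⊗ y ↦ x ⊗ Δ y` -/
def comulSnd (A : Type) [Ring A] [Algebra k A] : A ⊗[k] H →ₐ[k] A ⊗[k] (H ⊗[k] H) :=
  Algebra.TensorProduct.map (AlgHom.id k A) q.comul

/-- `x ⊗ y ↦ x ⊗ (y ⊗ 1)` -/
def unitRight (A B : Type) [Ring A] [Algebra k A] [Ring B] [Algebra k B] :
    A ⊗[k] B →ₐ[k] A ⊗[k] (B ⊗[k] H) :=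
  Algebra.TensorProduct.map (AlgHom.id k A) Algebra.TensorProduct.includeLeft

/-- `x ⊗ y ↦ μ(x) y` -/
def evalFst (mu : H →ₐ[k] k) (A : Type) [Ring A] [Algebra k A] : H ⊗[k] A →ₐ[k] A :=
  (Algebra.TensorProduct.lid k A).toAlgHom.comp
    (Algebra.TensorProduct.map mu (AlgHom.id k A))

/-- `x ⊗ y ↦ x ε(y)` -/
def counitSnd : H ⊗[k] H →ₐ[k] H :=
  (Algebra.TensorProduct.rid k k H).toAlgHom.comp
    (Algebra.TensorProduct.map (AlgHom.id k H) q.counit)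

/-- `x ⊗ y ⊗ z ↦ x ⊗ ε(y) z` -/
def counitMid : H ⊗[k] (H ⊗[k] H) →ₐ[k] H ⊗[k] H :=
  Algebra.TensorProduct.map (AlgHom.id k H) (evalFst q.counit H)

/-- `x ⊗ y ↦ x β S(y)` -/
def betaMul : H ⊗[k] H →ₗ[k] H :=
  TensorProduct.lift
    ((LinearMap.mul k H).compl₁₂ (LinearMap.mulRight k q.beta) q.S)

/-- `x ⊗ y ↦ S̄(α y) x` -/
def alphaMul : H ⊗[k] H →ₗ[k] H :=
  TensorProduct.lift
    ((LinearMap.mul k H).flip.compl₁₂ LinearMap.id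
      (q.Sinv.comp (LinearMap.mulLeft k q.alpha)))

/-- `a ⊗ b ⊗ c ⊗ d ↦ a β S(d) ⊗ b β S(c)` -/
def betaMulNested : H ⊗[k] (H ⊗[k] (H ⊗[k] H)) →ₗ[k] H ⊗[k] H :=
  (TensorProduct.map q.betaMul q.betaMul).comp
    ((TensorProduct.assoc k H H (H ⊗[k] H)).symm.toLinearMap.comp
      (TensorProduct.map LinearMap.id
        ((TensorProduct.comm k (H ⊗[k] H) H).toLinearMap.comp
          (TensorProduct.assoc k H H H).symm.toLinearMap)))

/-- `x ⊗ y ⊗ z ↦ x ⊗ S̄(α z) y` -/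
def alphaMulSnd : H ⊗[k] (H ⊗[k] H) →ₗ[k] H ⊗[k] H :=
  TensorProduct.map LinearMap.id q.alphaMul

@[simp]
lemma comulFst_tmul {A : Type} [Ring A] [Algebra k A] (x : H) (y : A) :
    q.comulFst A (x ⊗ₜ y) = TensorProduct.assoc k H H A (q.comul x ⊗ₜ y) := rfl

@[simp]
lemma comulSnd_tmul {A : Type} [Ring A] [Algebra k A] (x : A) (y : H) :
    q.comulSnd A (x ⊗ₜ y) = x ⊗ₜ q.comul y := rfl

@[simp]
lemma unitRight_tmul {A B : Type} [Ring A] [Algebra k A] [Ring B] [Algebra k B] (x : A) (y : B) :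
    unitRight (k := k) (H := H) A B (x ⊗ₜ y) = x ⊗ₜ (y ⊗ₜ 1) := rfl

@[simp]
lemma evalFst_tmul (mu : H →ₐ[k] k) {A : Type} [Ring A] [Algebra k A] (x : H) (y : A) :
    evalFst mu A (x ⊗ₜ y) = mu x • y := rfl

@[simp]
lemma counitSnd_tmul (x y : H) : q.counitSnd (x ⊗ₜ y) = q.counit y • x := rfl

@[simp]
lemma counitMid_tmul (x : H) (y : H ⊗[k] H) :
    q.counitMid (x ⊗ₜ y) = x ⊗ₜ evalFst q.counit H y := rfl

@[simp]
lemma betaMul_tmul (x y : H) : q.betaMul (x ⊗ₜ y) = x * q.beta * q.S y := rfl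

@[simp]
lemma alphaMul_tmul (x y : H) : q.alphaMul (x ⊗ₜ y) = q.Sinv (q.alpha * y) * x := rfl

@[simp]
lemma betaMulNested_tmul (a b c d : H) :
    q.betaMulNested (a ⊗ₜ (b ⊗ₜ (c ⊗ₜ d))) =
      (a * q.beta * q.S d) ⊗ₜ (b * q.beta * q.S c) := rfl

@[simp]
lemma alphaMulSnd_tmul (x : H) (y : H ⊗[k] H) :
    q.alphaMulSnd (x ⊗ₜ y) = x ⊗ₜ q.alphaMul y := rfl

lemma Sinv_mul (x y : H) : q.Sinv (x * y) = q.Sinv y * q.Sinv x := by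
  rw [← q.Sinv_S (q.Sinv y * q.Sinv x), q.S_mul, q.S_Sinv, q.S_Sinv]

lemma Phi_mul_PhiInv : q.Phi * q.PhiInv = 1 := q.phi_phiInv

lemma PhiInv_mul_Phi : q.PhiInv * q.Phi = 1 := q.phiInv_phi

lemma comulSnd_comul_mul_Phi (h : H) :
    q.comulSnd H (q.comul h) * q.Phi = q.Phi * q.comulFst H (q.comul h) := by
  have key : q.comulSnd H (q.comul h) = q.Phi * q.comulFst H (q.comul h) * q.PhiInv := by
    have := q.qcoassoc h
    rw [q.comul_eq h, map_sum, map_sum]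
    simp only [comulSnd_tmul, comulFst_tmul]
    rw [this, Phi, PhiInv]
    congr 2
    refine Finset.sum_congr rfl fun i _ => ?_
    rw [q.comul_eq (q.d1 h i)]
    simp [TensorProduct.sum_tmul]
  rw [key, mul_assoc, PhiInv_mul_Phi, mul_one]

lemma comulFst_comul_mul_PhiInv (h : H) :
    q.comulFst H (q.comul h) * q.PhiInv = q.PhiInv * q.comulSnd H (q.comul h) := by
  calc q.comulFst H (q.comul h) * q.PhiInv
      = q.PhiInv * (q.Phi * q.comulFst H (q.comul h)) * q.PhiInv := by
        rw [← mul_assoc, PhiInv_mul_Phi, one_mul]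
    _ = q.PhiInv * q.comulSnd H (q.comul h) := by
        rw [← comulSnd_comul_mul_Phi, mul_assoc, mul_assoc, Phi_mul_PhiInv, mul_one]

lemma evalFst_counit_comul (h : H) : evalFst q.counit H (q.comul h) = h := by
  conv_rhs => rw [← q.counit_left h]
  rw [q.comul_eq h]
  simp

lemma counitSnd_comul (h : H) : q.counitSnd (q.comul h) = h := by
  conv_rhs => rw [← q.counit_right h]
  rw [q.comul_eq h]
  simp

lemma betaMul_comul (h : H) : q.betaMul (q.comul h) = q.counit h • q.beta := by
  rw [← q.antipode_beta h, q.comul_eq h]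
  simp

lemma alphaMul_comul_mul (h : H) (t : H ⊗[k] H) :
    q.alphaMul (q.comul h * t) = q.counit h • q.alphaMul t := by
  induction t with
  | zero => simp
  | add s t hs ht => simp [mul_add, hs, ht]
  | tmul x y =>
    have key := congrArg q.Sinv (q.antipode_alpha h)
    rw [map_sum, map_smul] at key
    rw [q.comul_eq h]
    simp only [Finset.sum_mul, Algebra.TensorProduct.tmul_mul_tmul, map_sum, alphaMul_tmul]
    have : ∀ i, q.Sinv (q.alpha * (q.d2 h i * y)) * (q.d1 h i * x) =
        q.Sinv y * q.Sinv (q.S (q.d1 h i) * q.alpha * q.d2 h i) * x := fun i => by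
      simp only [Sinv_mul, Sinv_S, mul_assoc]
    simp only [this]
    rw [← Finset.sum_mul, ← Finset.mul_sum, key]
    simp [Sinv_mul]

lemma sswap_mul (s t : H ⊗[k] H) : q.sswap (s * t) = q.sswap t * q.sswap s := by
  induction s with
  | zero => simp
  | add s s' hs hs' => simp [add_mul, mul_add, hs, hs']
  | tmul a b =>
    induction t with
    | zero => simp
    | add t t' ht ht' => simp [add_mul, mul_add, ht, ht']
    | tmul c d => simp [sswap, S_mul]

lemma scop_eq (x : H) : q.scop x = q.sswap (q.comul x) := by
  rw [q.comul_eq x]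
  simp [scop, sswap]

lemma scop_mul (x y : H) : q.scop (x * y) = q.scop y * q.scop x := by
  simp only [scop_eq, map_mul, sswap_mul]

/-- `(x ⊗ y ⊗ z) ⊗ w ↦ x ⊗ y ⊗ z ⊗ w` -/
def reassoc : (H ⊗[k] (H ⊗[k] H)) ⊗[k] H →ₐ[k] H ⊗[k] (H ⊗[k] (H ⊗[k] H)) :=
  (Algebra.TensorProduct.map (AlgHom.id k H)
    (Algebra.TensorProduct.assoc k k k H H H).toAlgHom).comp
      (Algebra.TensorProduct.assoc k k k H (H ⊗[k] H) H).toAlgHom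

@[simp]
lemma reassoc_tmul (x : H) (t : H ⊗[k] H) (w : H) :
    reassoc ((x ⊗ₜ[k] t) ⊗ₜ[k] w) = x ⊗ₜ[k] TensorProduct.assoc k H H H (t ⊗ₜ[k] w) := rfl

lemma bEl_eq :
    q.bEl = q.betaMulNested (q.comulFst (H ⊗[k] H) q.Phi * reassoc (q.PhiInv ⊗ₜ 1)) := by
  have h1 : q.comulFst (H ⊗[k] H) q.Phi = ∑ a ∈ Finset.range q.np,
      ∑ m ∈ Finset.range (q.n (q.P1 a)),
        q.d1 (q.P1 a) m ⊗ₜ[k] (q.d2 (q.P1 a) m ⊗ₜ[k] (q.P2 a ⊗ₜ[k] q.P3 a)) := by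
    rw [Phi, map_sum]
    refine Finset.sum_congr rfl fun a _ => ?_
    rw [comulFst_tmul, q.comul_eq (q.P1 a)]
    simp [TensorProduct.sum_tmul]
  have h2 : reassoc (q.PhiInv ⊗ₜ 1) = ∑ b ∈ Finset.range q.nq,
      q.Q1 b ⊗ₜ[k] (q.Q2 b ⊗ₜ[k] (q.Q3 b ⊗ₜ[k] (1 : H))) := by
    simp [PhiInv, TensorProduct.sum_tmul]
  rw [h1, h2, bEl]
  simp only [Finset.sum_mul, map_sum]
  refine Finset.sum_congr rfl fun a _ => ?_
  rw [Finset.sum_comm]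
  simp only [Finset.mul_sum, map_sum, Algebra.TensorProduct.tmul_mul_tmul,
    betaMulNested_tmul, mul_one]

lemma mul_betaMulNested_mul_sswap (s t : H ⊗[k] H) (X : H ⊗[k] (H ⊗[k] (H ⊗[k] H))) :
    s * q.betaMulNested X * q.sswap t =
      q.betaMulNested (TensorProduct.assoc k H H (H ⊗[k] H) (s ⊗ₜ t) * X) := by
  induction s with
  | zero => simp
  | add s s' hs hs' => simp [add_mul, TensorProduct.add_tmul, hs, hs']
  | tmul a b =>
  induction t with
  | zero => simp
  | add t t' ht ht' => simp [add_mul, mul_add, TensorProduct.tmul_add, ht, ht']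
  | tmul c d =>
  induction X with
  | zero => simp
  | add X X' hX hX' => simp [add_mul, mul_add, hX, hX']
  | tmul x X =>
  induction X with
  | zero => simp
  | add X X' hX hX' => simp only [TensorProduct.tmul_add, map_add, add_mul, mul_add, hX, hX']
  | tmul y X =>
  induction X with
  | zero => simp
  | add X X' hX hX' => simp only [TensorProduct.tmul_add, map_add, add_mul, mul_add, hX, hX']
  | tmul z w => simp [sswap, S_mul, mul_assoc]

lemma comulFst_comulFst (t : H ⊗[k] H) :
    q.comulFst (H ⊗[k] H) (q.comulFst H t) =
      reassoc (Algebra.TensorProduct.map ((q.comulFst H).comp q.comul) (AlgHom.id k H) t) := by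
  induction t with
  | zero => simp
  | add s t hs ht => simp [hs, ht]
  | tmul x y =>
    simp only [comulFst_tmul, Algebra.TensorProduct.map_tmul, AlgHom.comp_apply, AlgHom.id_apply]
    induction q.comul x with
    | zero => simp
    | add s t hs ht => simp only [TensorProduct.add_tmul, map_add, hs, ht]
    | tmul a b =>
      simp only [TensorProduct.assoc_tmul, comulFst_tmul]
      induction q.comul a with
      | zero => simp
      | add s t hs ht => simp only [TensorProduct.add_tmul, map_add, hs, ht]
      | tmul c d => simp

lemma betaMulNested_mul_comulSnd (Z : H ⊗[k] (H ⊗[k] (H ⊗[k] H))) (s : H ⊗[k] H) (y : H) :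
    q.betaMulNested (Z * reassoc (q.comulSnd H s ⊗ₜ y)) =
      q.betaMulNested (Z * (q.counitSnd s ⊗ₜ (1 ⊗ₜ (1 ⊗ₜ y)))) := by
  induction s with
  | zero => simp
  | add s s' hs hs' => simp only [map_add, TensorProduct.add_tmul, mul_add, hs, hs']
  | tmul a c =>
  induction Z with
  | zero => simp
  | add X X' hX hX' => simp only [map_add, add_mul, hX, hX']
  | tmul z₁ Z =>
  induction Z with
  | zero => simp
  | add X X' hX hX' => simp only [TensorProduct.tmul_add, map_add, add_mul, hX, hX']
  | tmul z₂ Z =>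
  induction Z with
  | zero => simp
  | add X X' hX hX' => simp only [TensorProduct.tmul_add, map_add, add_mul, hX, hX']
  | tmul z₃ z₄ =>
    have key : ∀ t : H ⊗[k] H,
        q.betaMulNested ((z₁ ⊗ₜ (z₂ ⊗ₜ (z₃ ⊗ₜ z₄))) * reassoc ((a ⊗ₜ t) ⊗ₜ y)) =
          (z₁ * a * q.beta * q.S (z₄ * y)) ⊗ₜ (z₂ * q.betaMul t * q.S z₃) := fun t => by
      induction t with
      | zero => simp
      | add s t hs ht =>
        simp only [TensorProduct.tmul_add, TensorProduct.add_tmul, map_add, mul_add, add_mul,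
          hs, ht]
      | tmul u v => simp [S_mul, mul_assoc]
    rw [comulSnd_tmul, key, betaMul_comul]
    simp [TensorProduct.smul_tmul', mul_assoc]

lemma betaMulNested_mul_outer (Z : H ⊗[k] (H ⊗[k] (H ⊗[k] H))) (h : H) :
    ∑ i ∈ Finset.range (q.n h),
        q.betaMulNested (Z * (q.d1 h i ⊗ₜ (1 ⊗ₜ (1 ⊗ₜ q.d2 h i)))) =
      q.counit h • q.betaMulNested Z := by
  induction Z with
  | zero => simp
  | add X X' hX hX' => simp only [map_add, add_mul, Finset.sum_add_distrib, hX, hX', smul_add]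
  | tmul z₁ Z =>
  induction Z with
  | zero => simp
  | add X X' hX hX' =>
    simp only [TensorProduct.tmul_add, map_add, add_mul, Finset.sum_add_distrib, hX, hX', smul_add]
  | tmul z₂ Z =>
  induction Z with
  | zero => simp
  | add X X' hX hX' =>
    simp only [TensorProduct.tmul_add, map_add, add_mul, Finset.sum_add_distrib, hX, hX', smul_add]
  | tmul z₃ z₄ =>
    have : ∀ i, z₁ * q.d1 h i * q.beta * q.S (z₄ * q.d2 h i) =
        z₁ * (q.d1 h i * q.beta * q.S (q.d2 h i)) * q.S z₄ := fun i => by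
      simp only [S_mul, mul_assoc]
    simp only [Algebra.TensorProduct.tmul_mul_tmul, betaMulNested_tmul, mul_one, this]
    rw [← TensorProduct.sum_tmul, ← Finset.sum_mul, ← Finset.mul_sum, q.antipode_beta]
    simp [TensorProduct.smul_tmul']

/-- `x ⊗ y ↦ Δ(x) 𝕓 (S ⊗ S)(Δ^cop y)` -/
def bConj : H ⊗[k] H →ₗ[k] H ⊗[k] H :=
  TensorProduct.lift
    ((LinearMap.mul k (H ⊗[k] H)).compl₁₂
      ((LinearMap.mulRight k q.bEl).comp q.comul.toLinearMap)
      (q.sswap.comp q.comul.toLinearMap))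

@[simp]
lemma bConj_tmul (x y : H) : q.bConj (x ⊗ₜ y) = q.comul x * q.bEl * q.scop y := by
  rw [scop_eq]
  rfl

lemma bConj_eq (t : H ⊗[k] H) :
    q.bConj t = q.betaMulNested (q.comulFst (H ⊗[k] H) (q.comulSnd H t) *
      (q.comulFst (H ⊗[k] H) q.Phi * reassoc (q.PhiInv ⊗ₜ 1))) := by
  induction t with
  | zero => simp
  | add s t hs ht => simp only [map_add, add_mul, hs, ht]
  | tmul x y =>
    rw [bConj_tmul, scop_eq, bEl_eq, mul_betaMulNested_mul_sswap, comulSnd_tmul, comulFst_tmul]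

lemma bConj_comul (h : H) : q.bConj (q.comul h) = q.counit h • q.bEl := by
  have hphi : q.comulFst (H ⊗[k] H) (q.comulSnd H (q.comul h)) *
      (q.comulFst (H ⊗[k] H) q.Phi * reassoc (q.PhiInv ⊗ₜ 1)) =
      ∑ i ∈ Finset.range (q.n h),
        (q.comulFst (H ⊗[k] H) q.Phi * reassoc (q.PhiInv ⊗ₜ 1)) *
          reassoc (q.comulSnd H (q.comul (q.d1 h i)) ⊗ₜ q.d2 h i) := by
    rw [← mul_assoc, ← map_mul, comulSnd_comul_mul_Phi, map_mul, comulFst_comulFst, mul_assoc,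
      q.comul_eq h]
    simp only [map_sum, Finset.sum_mul, Finset.mul_sum, mul_assoc]
    refine Finset.sum_congr rfl fun i _ => ?_
    rw [← map_mul, ← map_mul]
    simp [comulFst_comul_mul_PhiInv]
  rw [bConj_eq, hphi, map_sum]
  simp only [betaMulNested_mul_comulSnd, counitSnd_comul]
  rw [betaMulNested_mul_outer, bEl_eq]

lemma bConj_one_tmul_mul (h : H) (t : H ⊗[k] H) :
    q.bConj ((1 ⊗ₜ h) * t) = q.bConj t * q.scop h := by
  induction t with
  | zero => simp
  | add s t hs ht => simp only [map_add, mul_add, add_mul, hs, ht]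
  | tmul x y => simp [scop_mul, mul_assoc]

lemma bConj_tmul_one_mul (h : H) (t : H ⊗[k] H) :
    q.bConj ((h ⊗ₜ 1) * t) = q.comul h * q.bConj t := by
  induction t with
  | zero => simp
  | add s t hs ht => simp only [map_add, mul_add, hs, ht]
  | tmul x y => simp [mul_assoc]

lemma bConj_tmul_mul (x y : H) (t : H ⊗[k] H) :
    q.bConj ((x ⊗ₜ y) * t) = q.comul x * q.bConj t * q.scop y := by
  induction t with
  | zero => simp
  | add s t hs ht => simp only [map_add, mul_add, add_mul, hs, ht]
  | tmul u v => simp [scop_mul, mul_assoc]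

lemma bConj_mul_comul (t : H ⊗[k] H) (h : H) :
    q.bConj (t * q.comul h) = q.counit h • q.bConj t := by
  induction t with
  | zero => simp
  | add s t hs ht => simp only [map_add, add_mul, hs, ht, smul_add]
  | tmul x y => simp [bConj_tmul_mul, bConj_comul]

lemma bConj_qLE : q.bConj q.qLE = q.twistInv := by
  simp [qLE, twistInv]

/-- `x ⊗ y ⊗ z ↦ S(x) α y ⊗ z` -/
def alphaMulFst : H ⊗[k] (H ⊗[k] H) →ₗ[k] H ⊗[k] H :=
  (TensorProduct.map (TensorProduct.lift
    ((LinearMap.mul k H).compl₁₂ ((LinearMap.mulRight k q.alpha).comp q.S) LinearMap.id))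
      LinearMap.id).comp (TensorProduct.assoc k H H H).symm.toLinearMap

@[simp]
lemma alphaMulFst_tmul (x y z : H) :
    q.alphaMulFst (x ⊗ₜ (y ⊗ₜ z)) = (q.S x * q.alpha * y) ⊗ₜ z := rfl

lemma alphaMulFst_mul_tmul (Z : H ⊗[k] (H ⊗[k] H)) (x : H) (t : H ⊗[k] H) :
    q.alphaMulFst (Z * (x ⊗ₜ t)) = (q.S x ⊗ₜ 1) * q.alphaMulFst Z * t := by
  induction t with
  | zero => simp
  | add s t hs ht => simp only [TensorProduct.tmul_add, map_add, mul_add, hs, ht]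
  | tmul u v =>
  induction Z with
  | zero => simp
  | add X X' hX hX' => simp only [map_add, add_mul, mul_add, hX, hX']
  | tmul z₁ Z =>
  induction Z with
  | zero => simp
  | add X X' hX hX' => simp only [TensorProduct.tmul_add, map_add, add_mul, mul_add, hX, hX']
  | tmul z₂ z₃ => simp [S_mul, mul_assoc]

lemma alphaMulFst_comulFst_mul (t : H ⊗[k] H) (Z : H ⊗[k] (H ⊗[k] H)) :
    q.alphaMulFst (q.comulFst H t * Z) =
      (1 ⊗ₜ evalFst q.counit H t) * q.alphaMulFst Z := by
  induction t with
  | zero => simp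
  | add s t hs ht => simp only [TensorProduct.tmul_add, map_add, add_mul, hs, ht]
  | tmul x y =>
  induction Z with
  | zero => simp
  | add X X' hX hX' => simp only [map_add, mul_add, hX, hX']
  | tmul z₁ Z =>
  induction Z with
  | zero => simp
  | add X X' hX hX' => simp only [TensorProduct.tmul_add, map_add, mul_add, hX, hX']
  | tmul z₂ z₃ =>
    rw [comulFst_tmul, q.comul_eq x]
    have : ∀ i, q.S (q.d1 x i * z₁) * q.alpha * (q.d2 x i * z₂) =
        q.S z₁ * (q.S (q.d1 x i) * q.alpha * q.d2 x i) * z₂ := fun i => by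
      simp only [S_mul, mul_assoc]
    simp only [TensorProduct.sum_tmul, map_sum, TensorProduct.assoc_tmul, Finset.sum_mul,
      Algebra.TensorProduct.tmul_mul_tmul, alphaMulFst_tmul, this]
    rw [← TensorProduct.sum_tmul, ← Finset.sum_mul, ← Finset.mul_sum, q.antipode_alpha]
    simp [TensorProduct.smul_tmul']

lemma alphaMulFst_PhiInv : q.alphaMulFst q.PhiInv = q.qLE := by
  simp [PhiInv, qLE, qL1, qL2]

lemma one_tmul_mul_qLE (h : H) :
    (1 ⊗ₜ h) * q.qLE = ∑ i ∈ Finset.range (q.n h),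
      (q.S (q.d1 h i) ⊗ₜ 1) * q.qLE * q.comul (q.d2 h i) := by
  calc (1 ⊗ₜ h) * q.qLE
      = q.alphaMulFst (q.comulFst H (q.comul h) * q.PhiInv) := by
        rw [alphaMulFst_comulFst_mul, evalFst_counit_comul, alphaMulFst_PhiInv]
    _ = _ := by
        rw [comulFst_comul_mul_PhiInv, q.comul_eq h]
        simp only [map_sum, Finset.mul_sum, comulSnd_tmul, alphaMulFst_mul_tmul,
          alphaMulFst_PhiInv]

/-- The inverse Drinfeld twist intertwines `Δ ∘ S` and `(S ⊗ S) ∘ Δ^cop`. -/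
lemma twistInv_mul_scop (h : H) : q.twistInv * q.scop h = q.comul (q.S h) * q.twistInv := by
  rw [← bConj_qLE, ← bConj_one_tmul_mul, one_tmul_mul_qLE, map_sum]
  simp only [mul_assoc, bConj_tmul_one_mul, bConj_mul_comul]
  conv_rhs => rw [← q.counit_right h]
  simp [Finset.sum_mul]

lemma evalFst_Phi (mu : H →ₐ[k] k) : evalFst mu (H ⊗[k] H) q.Phi =
    ∑ a ∈ Finset.range q.np, mu (q.P1 a) • (q.P2 a ⊗ₜ[k] q.P3 a) := by
  simp [Phi]

lemma evalFst_PhiInv (mu : H →ₐ[k] k) : evalFst mu (H ⊗[k] H) q.PhiInv =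
    ∑ b ∈ Finset.range q.nq, mu (q.Q1 b) • (q.Q2 b ⊗ₜ[k] q.Q3 b) := by
  simp [PhiInv]

lemma evalFst_Phi_mul_PhiInv (mu : H →ₐ[k] k) :
    evalFst mu (H ⊗[k] H) q.Phi * evalFst mu (H ⊗[k] H) q.PhiInv = 1 := by
  rw [← map_mul, Phi_mul_PhiInv, map_one]

lemma evalFst_PhiInv_mul_Phi (mu : H →ₐ[k] k) :
    evalFst mu (H ⊗[k] H) q.PhiInv * evalFst mu (H ⊗[k] H) q.Phi = 1 := by
  rw [← map_mul, PhiInv_mul_Phi, map_one]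

lemma evalFst_comul (mu : H →ₐ[k] k) (h : H) : evalFst mu H (q.comul h) = q.lhook mu h := rfl

/-- The pentagon identity with its first leg evaluated at a character. -/
lemma evalFst_pentagon (mu : H →ₐ[k] k) :
    q.comulSnd H (evalFst mu (H ⊗[k] H) q.Phi) *
        TensorProduct.map (q.lhook mu) LinearMap.id q.Phi =
      q.Phi * q.comulFst H (evalFst mu (H ⊗[k] H) q.Phi) *
        unitRight H H (evalFst mu (H ⊗[k] H) q.Phi) := by
  have key := congrArg (evalFst mu (H ⊗[k] (H ⊗[k] H))) q.pentagon
  simp only [map_mul] at key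
  convert key using 2
  · simp [evalFst_Phi]
  · simp only [Phi, map_sum, TensorProduct.map_tmul, LinearMap.id_apply]
    refine Finset.sum_congr rfl fun a _ => ?_
    rw [← evalFst_comul, q.comul_eq (q.P1 a)]
    simp [TensorProduct.sum_tmul, TensorProduct.smul_tmul']
  · congr 1
    · simp [Phi]
    · simp only [evalFst_Phi, map_sum, map_smul, evalFst_tmul, comulFst_tmul]
      refine Finset.sum_congr rfl fun a _ => ?_
      rw [q.comul_eq (q.P2 a)]
      simp [TensorProduct.sum_tmul, Finset.smul_sum]
  · simp [evalFst_Phi]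

lemma counitMid_Phi : q.counitMid q.Phi = 1 := by
  have key := q.counit_mid_phi
  rw [Algebra.TensorProduct.one_def, ← key]
  simp [Phi]

lemma counitMid_comulSnd (t : H ⊗[k] H) : q.counitMid (q.comulSnd H t) = t := by
  induction t with
  | zero => simp
  | add s t hs ht => simp only [map_add, hs, ht]
  | tmul x y => simp [evalFst_counit_comul]

lemma counitMid_comulFst (t : H ⊗[k] H) : q.counitMid (q.comulFst H t) = t := by
  induction t with
  | zero => simp
  | add s t hs ht => simp only [map_add, hs, ht]
  | tmul x y =>
    have key : ∀ s : H ⊗[k] H, q.counitMid (TensorProduct.assoc k H H H (s ⊗ₜ y)) =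
        q.counitSnd s ⊗ₜ y := fun s => by
      induction s with
      | zero => simp
      | add s t hs ht => simp only [TensorProduct.add_tmul, map_add, hs, ht]
      | tmul u v => simp [TensorProduct.smul_tmul]
    rw [comulFst_tmul, key, counitSnd_comul]

lemma counitMid_unitRight (t : H ⊗[k] H) :
    q.counitMid (unitRight H H t) = q.counitSnd t ⊗ₜ 1 := by
  induction t with
  | zero => simp
  | add s t hs ht => simp only [TensorProduct.add_tmul, map_add, hs, ht]
  | tmul x y => simp [TensorProduct.smul_tmul]

lemma counitMid_map_lhook (mu : H →ₐ[k] k) (Z : H ⊗[k] (H ⊗[k] H)) :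
    q.counitMid (TensorProduct.map (q.lhook mu) LinearMap.id Z) =
      TensorProduct.map (q.lhook mu) LinearMap.id (q.counitMid Z) := by
  induction Z with
  | zero => simp
  | add s t hs ht => simp only [map_add, hs, ht]
  | tmul x y => simp

lemma lhook_one (mu : H →ₐ[k] k) : q.lhook mu 1 = 1 := by
  rw [← evalFst_comul, map_one, map_one]

lemma counitSnd_evalFst_Phi (mu : H →ₐ[k] k) :
    q.counitSnd (evalFst mu (H ⊗[k] H) q.Phi) = 1 := by
  have key := congrArg q.counitMid (q.evalFst_pentagon mu)
  simp only [map_mul, counitMid_comulSnd, counitMid_comulFst, counitMid_unitRight,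
    counitMid_map_lhook, counitMid_Phi, one_mul] at key
  rw [Algebra.TensorProduct.one_def, TensorProduct.map_tmul, lhook_one, LinearMap.id_apply,
    ← Algebra.TensorProduct.one_def, mul_one] at key
  have key' := congrArg (fun t => q.counitSnd (evalFst mu (H ⊗[k] H) q.PhiInv * t)) key
  simpa [← mul_assoc, evalFst_PhiInv_mul_Phi] using key'.symm

lemma alphaMulSnd_Phi : q.alphaMulSnd q.Phi = q.qRE := by
  simp [Phi, qRE, qR1, qR2]

lemma alphaMulSnd_comulSnd_mul (t : H ⊗[k] H) (Z : H ⊗[k] (H ⊗[k] H)) :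
    q.alphaMulSnd (q.comulSnd H t * Z) = (q.counitSnd t ⊗ₜ 1) * q.alphaMulSnd Z := by
  induction t with
  | zero => simp
  | add s t hs ht => simp only [TensorProduct.add_tmul, map_add, add_mul, hs, ht]
  | tmul x y =>
  induction Z with
  | zero => simp
  | add X X' hX hX' => simp only [map_add, mul_add, hX, hX']
  | tmul z Z => simp [alphaMul_comul_mul, TensorProduct.smul_tmul']

lemma alphaMulSnd_mul_unitRight (Z : H ⊗[k] (H ⊗[k] H)) (t : H ⊗[k] H) :
    q.alphaMulSnd (Z * unitRight H H t) = q.alphaMulSnd Z * t := by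
  induction t with
  | zero => simp
  | add s t hs ht => simp only [map_add, mul_add, hs, ht]
  | tmul x y =>
  induction Z with
  | zero => simp
  | add X X' hX hX' => simp only [map_add, add_mul, hX, hX']
  | tmul z Z =>
  induction Z with
  | zero => simp
  | add X X' hX hX' => simp only [TensorProduct.tmul_add, map_add, add_mul, hX, hX']
  | tmul z₂ z₃ => simp [mul_assoc]

lemma alphaMulSnd_mul_comulFst_tmul (Z : H ⊗[k] (H ⊗[k] H)) (x y : H) :
    q.alphaMulSnd (Z * q.comulFst H (x ⊗ₜ y)) =
      (1 ⊗ₜ q.Sinv y) * q.alphaMulSnd Z * q.comul x := by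
  rw [comulFst_tmul]
  induction q.comul x with
  | zero => simp
  | add s t hs ht => simp only [TensorProduct.add_tmul, map_add, mul_add, hs, ht]
  | tmul u v =>
  induction Z with
  | zero => simp
  | add X X' hX hX' => simp only [map_add, add_mul, mul_add, hX, hX']
  | tmul z Z =>
  induction Z with
  | zero => simp
  | add X X' hX hX' => simp only [TensorProduct.tmul_add, map_add, add_mul, mul_add, hX, hX']
  | tmul z₂ z₃ => simp [Sinv_mul, mul_assoc]

lemma alphaMulSnd_map_lhook (mu : H →ₐ[k] k) (Z : H ⊗[k] (H ⊗[k] H)) :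
    q.alphaMulSnd (TensorProduct.map (q.lhook mu) LinearMap.id Z) =
      TensorProduct.map (q.lhook mu) LinearMap.id (q.alphaMulSnd Z) := by
  induction Z with
  | zero => simp
  | add s t hs ht => simp only [map_add, hs, ht]
  | tmul x y => simp

/-- `μ(φ̄1) (q^R_1 ↼ μ) φ̄2 ⊗ q^R_2 φ̄3 = μ(φ1) (1 ⊗ S̄(φ3)) q^R Δ(φ2)` -/
lemma map_lhook_qRE_mul (mu : H →ₐ[k] k) :
    TensorProduct.map (q.lhook mu) LinearMap.id q.qRE * evalFst mu (H ⊗[k] H) q.PhiInv =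
      ∑ a ∈ Finset.range q.np, mu (q.P1 a) •
        ((1 ⊗ₜ q.Sinv (q.P3 a)) * q.qRE * q.comul (q.P2 a)) := by
  have key := congrArg q.alphaMulSnd (q.evalFst_pentagon mu)
  rw [alphaMulSnd_comulSnd_mul, alphaMulSnd_mul_unitRight, counitSnd_evalFst_Phi,
    ← Algebra.TensorProduct.one_def, one_mul, alphaMulSnd_map_lhook, alphaMulSnd_Phi] at key
  rw [key, mul_assoc, evalFst_Phi_mul_PhiInv, mul_one, evalFst_Phi]
  simp only [map_sum, map_smul, Finset.mul_sum, mul_smul_comm, alphaMulSnd_mul_comulFst_tmul,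
    alphaMulSnd_Phi]

/-- `W^L = μ(φ1) Δ(S(φ2)) U^L (φ3 ⊗ 1)` -/
lemma WL_eq (mu : H →ₐ[k] k) :
    q.WL mu = ∑ a ∈ Finset.range q.np, mu (q.P1 a) •
      (q.comul (q.S (q.P2 a)) * q.UL * (q.P3 a ⊗ₜ 1)) := by
  rw [WL, ← evalFst_PhiInv, map_lhook_qRE_mul]
  simp only [map_sum, map_smul, Finset.mul_sum, mul_smul_comm]
  refine Finset.sum_congr rfl fun a _ => ?_
  rw [sswap_mul, sswap_mul, ← scop_eq, UL, ← mul_assoc, ← mul_assoc, twistInv_mul_scop]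
  simp [sswap, S_Sinv, S_one, mul_assoc]

end QuasiHopf

lemma hitR_mul_tmul_one {k H : Type} [Field k] [Ring H] [Algebra k H] (lam : H →ₗ[k] k)
    (t : H ⊗[k] H) (y : H) : hitR lam (t * (y ⊗ₜ 1)) = hitR lam t * y := by
  induction t with
  | zero => simp
  | add s t hs ht => simp only [map_add, add_mul, hs, ht]
  | tmul u v => simp [hitR]

namespace QuasiHopf

variable {k H : Type} [Field k] [Ring H] [Algebra k H] (q : QuasiHopf k H)

lemma hitR_WL (mu : H →ₐ[k] k) (lam : H →ₗ[k] k) (h : H) :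
    hitR lam (q.VL * q.comul h * q.WL mu) = ∑ a ∈ Finset.range q.np, mu (q.P1 a) •
      (hitR lam (q.VL * q.comul (h * q.S (q.P2 a)) * q.UL) * q.P3 a) := by
  rw [WL_eq]
  simp only [Finset.mul_sum, map_sum, mul_smul_comm, map_smul, ← hitR_mul_tmul_one, map_mul,
    mul_assoc]

/-- `x ⊗ y ↦ g(h S(x)) y` -/
def antipodeEval (g : H →ₗ[k] H) (h : H) : H ⊗[k] H →ₗ[k] H :=
  TensorProduct.lift
    ((LinearMap.mul k H).compl₁₂ (g.comp ((LinearMap.mulLeft k h).comp q.S)) LinearMap.id)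

@[simp]
lemma antipodeEval_tmul (g : H →ₗ[k] H) (h x y : H) :
    q.antipodeEval g h (x ⊗ₜ y) = g (h * q.S x) * y := rfl

lemma antipodeEval_one (g : H →ₗ[k] H) (h : H) : q.antipodeEval g h 1 = g h := by
  simp [Algebra.TensorProduct.one_def, S_one]

lemma antipodeEval_mul_tmul (g : H →ₗ[k] H) (h x y : H) (s : H ⊗[k] H) :
    q.antipodeEval g h (s * (x ⊗ₜ y)) = q.antipodeEval g (h * q.S x) s * y := by
  induction s with
  | zero => simp
  | add s t hs ht => simp only [map_add, add_mul, hs, ht]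
  | tmul u v => simp [S_mul, mul_assoc]

/-- If `s t = 1`, a relation `g'(h) = g(h S(s_1)) s_2` is inverted by `t`. -/
lemma antipodeEval_inverse {s t : H ⊗[k] H} (hst : s * t = 1) {g g' : H →ₗ[k] H}
    (hg : ∀ h, q.antipodeEval g h s = g' h) (h : H) : q.antipodeEval g' h t = g h := by
  have key : q.antipodeEval g h (s * t) = q.antipodeEval g' h t := by
    clear hst
    induction t with
    | zero => simp
    | add t t' ht ht' => simp only [map_add, mul_add, ht, ht']
    | tmul x y => rw [antipodeEval_mul_tmul, hg, antipodeEval_tmul]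
  rw [← key, hst, antipodeEval_one]

end QuasiHopf

/-- For `λ ∈ H*` the cointegral condition
`V^L_1 h₍₁₎ U^L_1 ⟨λ, V^L_2 h₍₂₎ U^L_2⟩ = μ(φ̄1) ⟨λ, h S(φ̄2)⟩ φ̄3` is equivalent to
`V^L_1 h₍₁₎ W^L_1 ⟨λ, V^L_2 h₍₂₎ W^L_2⟩ = λ(h) 1`. -/
theorem statement9 (k H : Type) [Field k] [Ring H] [Algebra k H] (q : QuasiHopf k H)
    (mu : H →ₐ[k] k) (lam : H →ₗ[k] k) :
    (∀ h : H, hitR lam (q.VL * q.comul h * q.UL) =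
        ∑ b ∈ Finset.range q.nq, (mu (q.Q1 b) * lam (h * q.S (q.Q2 b))) • q.Q3 b) ↔
    (∀ h : H, hitR lam (q.VL * q.comul h * q.WL mu) = lam h • (1 : H)) := by
  let G : H →ₗ[k] H := (hitR lam).comp ((LinearMap.mulRight k q.UL).comp
    ((LinearMap.mulLeft k q.VL).comp q.comul.toLinearMap))
  let L : H →ₗ[k] H := lam.smulRight 1
  have hG : ∀ h, hitR lam (q.VL * q.comul h * q.UL) = G h := fun h => rfl
  have hL : ∀ h, lam h • (1 : H) = L h := fun h => rfl
  have hi : ∀ h, ∑ b ∈ Finset.range q.nq, (mu (q.Q1 b) * lam (h * q.S (q.Q2 b))) • q.Q3 b =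
      q.antipodeEval L h (QuasiHopf.evalFst mu (H ⊗[k] H) q.PhiInv) := fun h => by
    simp [QuasiHopf.evalFst_PhiInv, L, mul_smul]
  have hii : ∀ h, hitR lam (q.VL * q.comul h * q.WL mu) =
      q.antipodeEval G h (QuasiHopf.evalFst mu (H ⊗[k] H) q.Phi) := fun h => by
    simp only [QuasiHopf.hitR_WL, QuasiHopf.evalFst_Phi, map_sum, map_smul,
      QuasiHopf.antipodeEval_tmul, hG]
  simp only [hG, hL, hi, hii]
  exact ⟨fun h₁ => q.antipodeEval_inverse (q.evalFst_PhiInv_mul_Phi mu) fun h => (h₁ h).symm,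
    fun h₂ h => (q.antipodeEval_inverse (q.evalFst_Phi_mul_PhiInv mu) h₂ h).symm⟩
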